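/- If the boundary of K is C^{k,α} (k ≥ 1, 0 ≤ α ≤ 1) in a neighborhood of a point x₀ ∈ ∂K, then the gauge γ_K is C^{k,α} in a neighborhood of every point t·x₀ with t > 0. -/

import Mathlib

open RealInnerProductSpace

/-- A function `f` is `C^{k,α}` on a set `s`: it is `C^k` on `s` and its `k`-th derivative is
`α`-Hölder continuous on `s`. -/
def IsCkAlphaOn {n : ℕ} (k : ℕ) (α : ℝ) (f : EuclideanSpace ℝ (Fin n) → ℝ)
    (s : Set (EuclideanSpace ℝ (Fin n))) : Prop :=
  ContDiffOn ℝ k f s ∧ ∃ C : ℝ, 0 ≤ C ∧ ∀ x ∈ s, ∀ y ∈ s,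
    ‖iteratedFDerivWithin ℝ k f s x - iteratedFDerivWithin ℝ k f s y‖ ≤ C * ‖x - y‖ ^ α

open Filter Topology

/-- Local Hölder continuity of exponent `α` near the point `x`. -/
def LocHol {E F : Type} [NormedAddCommGroup E] [NormedAddCommGroup F] (α : ℝ) (f : E → F) (x : E) :
    Prop :=
  ∃ C : ℝ, 0 ≤ C ∧ ∀ᶠ p in 𝓝 (x, x), ‖f p.1 - f p.2‖ ≤ C * ‖p.1 - p.2‖ ^ α

/-- `f` is `C^{k,α}` near the point `x`. -/
def HolAt {E F : Type} [NormedAddCommGroup E] [NormedSpace ℝ E] [NormedAddCommGroup F]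
    [NormedSpace ℝ F] (k : ℕ) (α : ℝ) (f : E → F) (x : E) : Prop :=
  ContDiffAt ℝ k f x ∧ LocHol α (iteratedFDeriv ℝ k f) x

section LH
set_option linter.unusedSectionVars false
variable {E F G : Type} [NormedAddCommGroup E] [NormedSpace ℝ E] [NormedAddCommGroup F]
    [NormedSpace ℝ F] [NormedAddCommGroup G] [NormedSpace ℝ G]

theorem both_eventually {x : E} {P : E → Prop} (h : ∀ᶠ y in 𝓝 x, P y) :
    ∀ᶠ p in 𝓝 (x, x), P p.1 ∧ P p.2 :=
  (continuous_fst.tendsto (x, x) |>.eventually h).and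
    (continuous_snd.tendsto (x, x) |>.eventually h)

theorem near_one (x : E) : ∀ᶠ p in 𝓝 (x, x), ‖p.1 - p.2‖ ≤ 1 := by
  have : Continuous fun p : E × E => ‖p.1 - p.2‖ := by fun_prop
  have h := this.tendsto (x, x)
  simp only [sub_self, norm_zero] at h
  exact h.eventually (ge_mem_nhds one_pos)

theorem LocHol.congr {α : ℝ} {f g : E → F} {x : E} (h : LocHol α f x) (hfg : f =ᶠ[𝓝 x] g) :
    LocHol α g x := by
  obtain ⟨C, hC, h⟩ := h
  refine ⟨C, hC, ?_⟩
  filter_upwards [h, both_eventually hfg] with p hp hq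
  rw [← hq.1, ← hq.2]; exact hp

theorem ContDiffAt.locLip {f : E → F} {x : E} (h : ContDiffAt ℝ 1 f x) :
    ∃ C : ℝ, 0 ≤ C ∧ ∀ᶠ p in 𝓝 (x, x), ‖f p.1 - f p.2‖ ≤ C * ‖p.1 - p.2‖ := by
  obtain ⟨K, s, hs, hl⟩ := h.exists_lipschitzOnWith
  refine ⟨K, K.2, ?_⟩
  filter_upwards [both_eventually hs] with p hp
  simpa [dist_eq_norm] using hl.dist_le_mul _ hp.1 _ hp.2

theorem ContDiffAt.locHol {α : ℝ} (h1 : α ≤ 1) {f : E → F} {x : E}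
    (h : ContDiffAt ℝ 1 f x) : LocHol α f x := by
  obtain ⟨C, hC, h⟩ := h.locLip
  refine ⟨max C (‖f x - f x‖), by positivity, ?_⟩
  filter_upwards [h, near_one x] with p hp hq
  by_cases h0 : ‖p.1 - p.2‖ = 0
  · have : p.1 = p.2 := by rwa [norm_eq_zero, sub_eq_zero] at h0
    simp only [this, sub_self, norm_zero]
    positivity
  refine hp.trans ?_
  have : ‖p.1 - p.2‖ ≤ ‖p.1 - p.2‖ ^ α := by
    have := Real.rpow_le_rpow_of_exponent_ge (lt_of_le_of_ne (norm_nonneg _) (Ne.symm h0)) hq h1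
    simpa using this
  gcongr
  exact le_max_left _ _

theorem LocHol.add {α : ℝ} {f g : E → F} {x : E} (hf : LocHol α f x) (hg : LocHol α g x) :
    LocHol α (fun y => f y + g y) x := by
  obtain ⟨C, hC, hf⟩ := hf
  obtain ⟨D, hD, hg⟩ := hg
  refine ⟨C + D, by positivity, ?_⟩
  filter_upwards [hf, hg] with p hp hq
  calc _ = ‖(f p.1 - f p.2) + (g p.1 - g p.2)‖ := by congr 1; abel
    _ ≤ _ := norm_add_le _ _
    _ ≤ _ := by rw [add_mul]; gcongr

theorem locBdd {f : E → F} {x : E} (hf : ContinuousAt f x) :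
    ∀ᶠ y in 𝓝 x, ‖f y‖ ≤ ‖f x‖ + 1 :=
  (hf.norm.eventually (ge_mem_nhds (lt_add_one _)))

theorem LocHol.bilin {α : ℝ} {H : Type} [NormedAddCommGroup H] [NormedSpace ℝ H]
    (B : F →L[ℝ] G →L[ℝ] H) {f : E → F} {g : E → G} {x : E}
    (cf : ContinuousAt f x) (cg : ContinuousAt g x)
    (hf : LocHol α f x) (hg : LocHol α g x) : LocHol α (fun y => B (f y) (g y)) x := by
  obtain ⟨C, hC, hf⟩ := hf
  obtain ⟨D, hD, hg⟩ := hg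
  refine ⟨‖B‖ * C * (‖g x‖ + 1) + ‖B‖ * (‖f x‖ + 1) * D, by positivity, ?_⟩
  filter_upwards [hf, hg, both_eventually (locBdd cf), both_eventually (locBdd cg)]
    with p h1 h2 h3 h4
  calc _ = ‖B (f p.1 - f p.2) (g p.1) + B (f p.2) (g p.1 - g p.2)‖ := by
          congr 1; simp
    _ ≤ _ := norm_add_le _ _
    _ ≤ ‖B‖ * ‖f p.1 - f p.2‖ * ‖g p.1‖ + ‖B‖ * ‖f p.2‖ * ‖g p.1 - g p.2‖ :=
        add_le_add (B.le_opNorm₂ _ _) (B.le_opNorm₂ _ _)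
    _ ≤ ‖B‖ * (C * ‖p.1 - p.2‖ ^ α) * (‖g x‖ + 1)
        + ‖B‖ * (‖f x‖ + 1) * (D * ‖p.1 - p.2‖ ^ α) := by
        gcongr
        · exact h4.1
        · exact h3.2
    _ = _ := by ring

theorem LocHol.comp {α : ℝ} (h0 : 0 ≤ α) {g : F → G} {f : E → F} {x : E}
    (hg : LocHol α g (f x)) (hf : ContDiffAt ℝ 1 f x) : LocHol α (fun y => g (f y)) x := by
  obtain ⟨C, hC, hg⟩ := hg
  obtain ⟨D, hD, hl⟩ := hf.locLip
  have ht : Tendsto (Prod.map f f) (𝓝 (x, x)) (𝓝 (f x, f x)) :=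
    (hf.continuousAt.prodMap hf.continuousAt : ContinuousAt (Prod.map f f) (x, x))
  refine ⟨C * D ^ α, by positivity, ?_⟩
  filter_upwards [ht.eventually hg, hl] with p h1 h2
  refine h1.trans ?_
  rw [mul_assoc, ← Real.mul_rpow hD (norm_nonneg _)]
  simp only [Prod.map_fst, Prod.map_snd]
  gcongr

/-- Postcomposition with an isometry. -/
theorem LocHol.isom {α : ℝ} {f : E → F} {x : E} {g : E → G}
    (h : ∀ y z, ‖g y - g z‖ = ‖f y - f z‖) (hf : LocHol α f x) : LocHol α g x := by
  obtain ⟨C, hC, hf⟩ := hf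
  refine ⟨C, hC, ?_⟩
  filter_upwards [hf] with p hp
  rw [h]; exact hp

theorem holAt_zero_iff {α : ℝ} {f : E → F} {x : E} :
    HolAt 0 α f x ↔ ContDiffAt ℝ 0 f x ∧ LocHol α f x := by
  have key : ∀ y z, ‖iteratedFDeriv ℝ 0 f y - iteratedFDeriv ℝ 0 f z‖ = ‖f y - f z‖ := by
    intro y z
    rw [iteratedFDeriv_zero_eq_comp]
    simp only [Function.comp]
    rw [← map_sub, LinearIsometryEquiv.norm_map]
  exact ⟨fun h => ⟨h.1, h.2.isom fun y z => (key y z).symm⟩, fun h => ⟨h.1, h.2.isom key⟩⟩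

theorem contDiffAt_succ_iff' {k : ℕ} {f : E → F} {x : E} :
    ContDiffAt ℝ (k + 1 : ℕ) f x ↔
      (∀ᶠ y in 𝓝 x, DifferentiableAt ℝ f y) ∧ ContDiffAt ℝ k (fderiv ℝ f) x := by
  constructor
  · intro h
    refine ⟨?_, h.fderiv_right (by push_cast; exact le_rfl)⟩
    have := h.eventually (by simp)
    filter_upwards [this] with y hy
    exact hy.differentiableAt (by simp)
  · rintro ⟨h, h'⟩
    push_cast
    exact contDiffAt_succ_iff_hasFDerivAt.2
      ⟨fderiv ℝ f, ⟨_, h, fun y hy => DifferentiableAt.hasFDerivAt hy⟩, h'⟩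

theorem holAt_succ_iff {k : ℕ} {α : ℝ} {f : E → F} {x : E} :
    HolAt (k + 1) α f x ↔ (∀ᶠ y in 𝓝 x, DifferentiableAt ℝ f y) ∧ HolAt k α (fderiv ℝ f) x := by
  have key : ∀ y z, ‖iteratedFDeriv ℝ (k + 1) f y - iteratedFDeriv ℝ (k + 1) f z‖
      = ‖iteratedFDeriv ℝ k (fderiv ℝ f) y - iteratedFDeriv ℝ k (fderiv ℝ f) z‖ := by
    intro y z
    rw [iteratedFDeriv_succ_eq_comp_right, iteratedFDeriv_succ_eq_comp_right]
    rw [← dist_eq_norm, ← dist_eq_norm]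
    exact (continuousMultilinearCurryRightEquiv' ℝ k E F).symm.dist_map _ _
  unfold HolAt
  rw [contDiffAt_succ_iff', and_assoc]
  refine and_congr_right fun _ => and_congr_right fun _ =>
    ⟨fun h => h.isom fun y z => (key y z).symm, fun h => h.isom key⟩

theorem HolAt.congr {k : ℕ} {α : ℝ} {f g : E → F} {x : E} (h : HolAt k α f x)
    (hfg : f =ᶠ[𝓝 x] g) : HolAt k α g x :=
  ⟨h.1.congr_of_eventuallyEq hfg.symm, h.2.congr (hfg.iteratedFDeriv ℝ k)⟩

theorem ContDiffAt.holAt {k : ℕ} {α : ℝ} (h1 : α ≤ 1) {f : E → F} {x : E}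
    (h : ContDiffAt ℝ (k + 1 : ℕ) f x) : HolAt k α f x := by
  refine ⟨h.of_le (by norm_cast; omega), ?_⟩
  exact ContDiffAt.locHol h1 (h.iteratedFDeriv_right (by push_cast; rw [add_comm]))

theorem HolAt.of_succ {k : ℕ} {α : ℝ} (h1 : α ≤ 1) {f : E → F} {x : E}
    (h : HolAt (k + 1) α f x) : HolAt k α f x := h.1.holAt h1

theorem HolAt.add {k : ℕ} {α : ℝ} {f g : E → F} {x : E} (hf : HolAt k α f x)
    (hg : HolAt k α g x) : HolAt k α (fun y => f y + g y) x := by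
  refine ⟨hf.1.add hg.1, (hf.2.add hg.2).congr ?_⟩
  filter_upwards [hf.1.eventually (by simp), hg.1.eventually (by simp)] with y h1 h2
  exact (iteratedFDeriv_add_apply h1 h2).symm

end LH

section LH2
variable {E : Type} [NormedAddCommGroup E] [NormedSpace ℝ E]

theorem HolAt.bilin {α : ℝ} (h1 : α ≤ 1) (k : ℕ) : ∀ {F G H : Type} [NormedAddCommGroup F]
    [NormedSpace ℝ F] [NormedAddCommGroup G] [NormedSpace ℝ G] [NormedAddCommGroup H]
    [NormedSpace ℝ H] (B : F →L[ℝ] G →L[ℝ] H) {f : E → F} {g : E → G} {x : E}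
    (_ : HolAt k α f x) (_ : HolAt k α g x), HolAt k α (fun y => B (f y) (g y)) x := by
  induction k with
  | zero =>
    intro F G H _ _ _ _ _ _ B f g x hf hg
    rw [holAt_zero_iff] at *
    refine ⟨?_, hf.2.bilin B hf.1.continuousAt hg.1.continuousAt hg.2⟩
    exact B.isBoundedBilinearMap.contDiff.contDiffAt.comp x (hf.1.prodMk hg.1)
  | succ k ih =>
    intro F G H _ _ _ _ _ _ B f g x hf hg
    have hf' := holAt_succ_iff.1 hf
    have hg' := holAt_succ_iff.1 hg
    rw [holAt_succ_iff]
    have key : ∀ᶠ y in 𝓝 x, HasFDerivAt (fun y => B (f y) (g y))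
        (B.precompR E (f y) (fderiv ℝ g y) + B.precompL E (fderiv ℝ f y) (g y)) y := by
      filter_upwards [hf'.1, hg'.1] with y h1 h2
      exact B.hasFDerivAt_of_bilinear h1.hasFDerivAt h2.hasFDerivAt
    refine ⟨key.mono fun y hy => hy.differentiableAt, ?_⟩
    refine HolAt.congr ((ih (B.precompR E) (hf.of_succ h1) hg'.2).add
      (ih (B.precompL E) hf'.2 (hg.of_succ h1))) ?_
    filter_upwards [key] with y hy
    exact hy.fderiv.symm

theorem HolAt.comp {α : ℝ} (h0 : 0 ≤ α) (h1 : α ≤ 1) (k : ℕ) : ∀ {F G : Type}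
    [NormedAddCommGroup F] [NormedSpace ℝ F] [NormedAddCommGroup G] [NormedSpace ℝ G]
    {g : F → G} {f : E → F} {x : E}
    (_ : HolAt k α g (f x)) (_ : ContDiffAt ℝ (k + 1 : ℕ) f x),
    HolAt k α (fun y => g (f y)) x := by
  induction k with
  | zero =>
    intro F G _ _ _ _ g f x hg hf
    rw [holAt_zero_iff] at *
    exact ⟨hg.1.comp x (hf.of_le (by simp)), hg.2.comp h0 (by simpa using hf)⟩
  | succ k ih =>
    intro F G _ _ _ _ g f x hg hf
    have hg' := holAt_succ_iff.1 hg
    have hf' := contDiffAt_succ_iff'.1 hf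
    have key : ∀ᶠ y in 𝓝 x, HasFDerivAt (fun y => g (f y))
        ((fderiv ℝ g (f y)).comp (fderiv ℝ f y)) y := by
      filter_upwards [hf'.1, hf.continuousAt.eventually hg'.1] with y h1 h2
      exact h2.hasFDerivAt.comp y h1.hasFDerivAt
    rw [holAt_succ_iff]
    refine ⟨key.mono fun y hy => hy.differentiableAt, ?_⟩
    refine HolAt.congr (HolAt.bilin h1 k (ContinuousLinearMap.compL ℝ E F G)
      (ih hg'.2 (hf.of_le (by norm_cast; omega))) (hf'.2.holAt h1)) ?_
    filter_upwards [key] with y hy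
    exact hy.fderiv.symm

theorem HolAt.inv {α : ℝ} (h0 : 0 ≤ α) (h1 : α ≤ 1) (k : ℕ) : ∀ {u : E → ℝ} {x : E}
    (_ : HolAt k α u x) (_ : u x ≠ 0), HolAt k α (fun y => (u y)⁻¹) x := by
  induction k with
  | zero =>
    intro u x hu hx
    rw [holAt_zero_iff] at *
    refine ⟨hu.1.inv hx, ?_⟩
    have c : ContinuousAt (fun y => (u y)⁻¹) x := hu.1.continuousAt.inv₀ hx
    obtain ⟨C, hC, h⟩ := hu.2
    refine ⟨(‖(u x)⁻¹‖ + 1) * (‖(u x)⁻¹‖ + 1) * C, by positivity, ?_⟩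
    filter_upwards [h, both_eventually (locBdd c),
      both_eventually (hu.1.continuousAt.eventually_ne hx)] with p h2 h3 h4
    have : (u p.1)⁻¹ - (u p.2)⁻¹ = - ((u p.1)⁻¹ * (u p.2)⁻¹ * (u p.1 - u p.2)) := by
      have := h4.1
      have := h4.2
      field_simp
      ring
    rw [this, norm_neg, norm_mul, norm_mul, mul_assoc _ C]
    gcongr
    exacts [h3.1, h3.2]
  | succ k ih =>
    intro u x hu hx
    have hu' := holAt_succ_iff.1 hu
    have key : ∀ᶠ y in 𝓝 x, HasFDerivAt (fun y => (u y)⁻¹)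
        ((-((u y)⁻¹ * (u y)⁻¹)) • (fderiv ℝ u y)) y := by
      filter_upwards [hu'.1, hu.1.continuousAt.eventually_ne hx] with y h1 h2
      have := (hasDerivAt_inv h2).comp_hasFDerivAt y h1.hasFDerivAt
      have e : -((u y)⁻¹ * (u y)⁻¹) = -((u y) ^ 2)⁻¹ := by rw [← mul_inv, sq]
      rw [e]
      exact this
    rw [holAt_succ_iff]
    refine ⟨key.mono fun y hy => hy.differentiableAt, ?_⟩
    have hi := ih (hu.of_succ h1) hx
    have hm := HolAt.bilin h1 k (-ContinuousLinearMap.mul ℝ ℝ) hi hi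
    refine HolAt.congr (HolAt.bilin h1 k (ContinuousLinearMap.lsmul ℝ ℝ) hm hu'.2) ?_
    filter_upwards [key] with y hy
    rw [hy.fderiv]
    simp
end LH2


theorem transversal {E : Type} [NormedAddCommGroup E] [NormedSpace ℝ E] {K : Set E}
    (hKconv : Convex ℝ K) (h0 : K ∈ 𝓝 (0 : E)) {x₀ : E} (hx₀ : gauge K x₀ = 1)
    {V : Set E} (hV : V ∈ 𝓝 x₀) {f : E → ℝ} (hf : ContinuousOn f V)
    (hd : DifferentiableAt ℝ f x₀) (hz : ∀ x ∈ V, f x = 0 ↔ gauge K x = 1)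
    (hne : fderiv ℝ f x₀ ≠ 0) : fderiv ℝ f x₀ x₀ ≠ 0 := by
  intro hbad
  obtain ⟨w, hw⟩ : ∃ w, fderiv ℝ f x₀ w ≠ 0 := by
    by_contra! h
    exact hne (by ext v; simpa using h v)
  obtain ⟨ε, hε, hball⟩ := Metric.mem_nhds_iff.1 hV
  obtain ⟨r, hr, hrball⟩ := Metric.mem_nhds_iff.1 h0
  have hgl : ∀ y, ‖y‖ < r → gauge K y < 1 := fun y hy =>
    interior_subset_gauge_lt_one K (interior_mono hrball
      (by rw [Metric.isOpen_ball.interior_eq]; simpa using hy))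
  -- a short vector `v` along which `f` increases
  obtain ⟨v, hv, hvr⟩ : ∃ v, 0 < fderiv ℝ f x₀ v ∧ ‖v‖ < r := by
    set a := fderiv ℝ f x₀ w with ha
    have hwn : 0 < ‖w‖ := norm_pos_iff.2 (by rintro rfl; simp at ha; exact hw ha)
    rcases lt_or_gt_of_ne hw with h | h
    · refine ⟨(-(r / (2 * ‖w‖))) • w, ?_, ?_⟩
      · rw [map_smul, smul_eq_mul, ← ha]
        have : 0 < r / (2 * ‖w‖) := by positivity
        nlinarith
      · rw [norm_smul, norm_neg, Real.norm_of_nonneg (by positivity)]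
        field_simp
        linarith
    · refine ⟨((r / (2 * ‖w‖))) • w, ?_, ?_⟩
      · rw [map_smul, smul_eq_mul, ← ha]
        positivity
      · rw [norm_smul, Real.norm_of_nonneg (by positivity)]
        field_simp
        linarith
  have hfx : f x₀ = 0 := (hz x₀ (mem_of_mem_nhds hV)).2 hx₀
  have hder : ∀ u : E, HasDerivAt (fun s : ℝ => f (x₀ + s • (x₀ + u))) (fderiv ℝ f x₀ u) 0 := by
    intro u
    have h1 : HasDerivAt (fun s : ℝ => x₀ + s • (x₀ + u)) (x₀ + u) 0 := by
      simpa using ((hasDerivAt_id (0 : ℝ)).smul_const (x₀ + u)).const_add x₀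
    have h2 : HasFDerivAt f (fderiv ℝ f x₀) (x₀ + (0 : ℝ) • (x₀ + u)) := by
      simpa using hd.hasFDerivAt
    have := h2.comp_hasDerivAt (0 : ℝ) h1
    rw [map_add, hbad, zero_add] at this
    exact this
  have hpos : ∀ᶠ s in 𝓝[>] (0 : ℝ), 0 < f (x₀ + s • (x₀ + v)) := by
    have := (hasDerivWithinAt_iff_tendsto_slope' (s := Set.Ioi (0 : ℝ)) (by simp)).1
      (hder v).hasDerivWithinAt
    filter_upwards [this.eventually (lt_mem_nhds hv), self_mem_nhdsWithin] with s h1 h2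
    have h2 : 0 < s := h2
    rw [slope_def_field] at h1
    simp only [zero_smul, add_zero, hfx, sub_zero] at h1
    exact (div_pos_iff_of_pos_right h2).1 h1
  have hneg : ∀ᶠ s in 𝓝[>] (0 : ℝ), f (x₀ + s • (x₀ + (-v))) < 0 := by
    have := (hasDerivWithinAt_iff_tendsto_slope' (s := Set.Ioi (0 : ℝ)) (by simp)).1
      (hder (-v)).hasDerivWithinAt
    filter_upwards [this.eventually (gt_mem_nhds (show fderiv ℝ f x₀ (-v) < 0 by simpa using hv)),
      self_mem_nhdsWithin] with s h1 h2
    have h2 : 0 < s := h2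
    rw [slope_def_field] at h1
    simp only [zero_smul, add_zero, hfx, sub_zero] at h1
    by_contra! h3
    exact absurd (div_nonneg h3 h2.le) (not_le.2 h1)
  have hsmall : ∀ᶠ s in 𝓝[>] (0 : ℝ), s * (‖x₀‖ + ‖v‖) < ε := by
    have : Continuous fun s : ℝ => s * (‖x₀‖ + ‖v‖) := by fun_prop
    have h := this.tendsto 0
    simp only [zero_mul] at h
    exact (h.mono_left nhdsWithin_le_nhds).eventually (gt_mem_nhds hε)
  obtain ⟨s, hp, hn, hs, hs0⟩ := (hpos.and (hneg.and (hsmall.and self_mem_nhdsWithin))).exists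
  have hs0 : 0 < s := hs0
  set c : ℝ → E := fun τ => x₀ + s • (x₀ + τ • v) with hc
  have hcV : ∀ τ ∈ Set.Icc (-1 : ℝ) 1, c τ ∈ V := by
    intro τ hτ
    apply hball
    rw [mem_ball_iff_norm]
    have : c τ - x₀ = s • (x₀ + τ • v) := by simp [hc]
    rw [this, norm_smul, Real.norm_of_nonneg hs0.le]
    refine lt_of_le_of_lt ?_ hs
    gcongr
    refine (norm_add_le _ _).trans ?_
    gcongr
    rw [norm_smul]
    have : ‖τ‖ ≤ 1 := abs_le.2 hτ
    nlinarith [norm_nonneg v]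
  have hcc : ContinuousOn (fun τ => f (c τ)) (Set.Icc (-1) 1) :=
    hf.comp (by fun_prop) hcV
  obtain ⟨τ, hτ, hτ0⟩ := intermediate_value_Icc (by norm_num : (-1 : ℝ) ≤ 1) hcc
    (show (0 : ℝ) ∈ Set.Icc (f (c (-1))) (f (c 1)) by
      constructor
      · simpa [hc] using hn.le
      · simpa [hc] using hp.le)
  have hg1 : gauge K (c τ) = 1 := (hz _ (hcV τ hτ)).1 hτ0
  have hg2 : gauge K ((-τ) • v) < 1 := by
    apply hgl
    rw [norm_smul, norm_neg]
    have : ‖τ‖ ≤ 1 := abs_le.2 hτ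
    nlinarith [norm_nonneg v]
  have hsum : (1 + s) • x₀ = c τ + s • ((-τ) • v) := by
    simp only [hc]; module
  have h1 : gauge K ((1 + s) • x₀) = 1 + s := by
    rw [gauge_smul_of_nonneg (by positivity), hx₀, smul_eq_mul, mul_one]
  have h2 : gauge K (s • ((-τ) • v)) = s * gauge K ((-τ) • v) := by
    rw [gauge_smul_of_nonneg hs0.le, smul_eq_mul]
  have h3 := gauge_add_le hKconv (absorbent_nhds_zero h0) (c τ) (s • ((-τ) • v))
  rw [← hsum, h1, h2, hg1] at h3
  nlinarith

theorem gauge_contDiffAt {E : Type} [NormedAddCommGroup E] [NormedSpace ℝ E] [CompleteSpace E]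
    {φ : E → ℝ} {x₀ : E} {t : ℝ} (ht : 0 < t) (hφ : ContinuousAt φ (t • x₀)) (hφt : φ (t • x₀) = t)
    {k : ℕ} (hk : 1 ≤ k) {f : E → ℝ} (hf : ContDiffAt ℝ k f x₀) (hfx : f x₀ = 0)
    (htr : fderiv ℝ f x₀ x₀ ≠ 0)
    (hz : ∀ᶠ x in 𝓝 (t • x₀), f ((φ x)⁻¹ • x) = 0) : ContDiffAt ℝ k φ (t • x₀) := by
  set F : E × ℝ → ℝ := fun p => f (p.2⁻¹ • p.1) with hF
  set u : E × ℝ := (t • x₀, t) with hu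
  have hux : u.2⁻¹ • u.1 = x₀ := by simp [hu, smul_smul, ht.ne']
  have hFc : ContDiffAt ℝ k F u := by
    have h1 : ContDiffAt ℝ k (fun p : E × ℝ => p.2⁻¹ • p.1) u :=
      (contDiffAt_snd.inv ht.ne').smul contDiffAt_fst
    exact ContDiffAt.comp u (by rw [hux]; exact hf) h1
  have hk0 : (k : WithTop ℕ∞) ≠ 0 := by
    simp; omega
  have hFd : DifferentiableAt ℝ F u := hFc.differentiableAt hk0
  have hval : ∀ μ : ℝ, (fderiv ℝ F u ∘L .inr ℝ E ℝ) μ = (-(t⁻¹) * fderiv ℝ f x₀ x₀) * μ := by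
    have h1 : HasDerivAt (fun s : ℝ => F (t • x₀, s)) (fderiv ℝ F u (0, 1)) t := by
      have hc : HasDerivAt (fun s : ℝ => (t • x₀, s)) ((0 : E), (1 : ℝ)) t :=
        (hasDerivAt_const t (t • x₀)).prodMk (hasDerivAt_id t)
      exact (hFd.hasFDerivAt (x := u)).comp_hasDerivAt t hc
    have h2 : HasDerivAt (fun s : ℝ => F (t • x₀, s)) (-(t⁻¹) * fderiv ℝ f x₀ x₀) t := by
      have hc : HasDerivAt (fun s : ℝ => s⁻¹ • (t • x₀)) ((-(t ^ 2)⁻¹) • (t • x₀)) t :=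
        (hasDerivAt_inv ht.ne').smul_const (t • x₀)
      have hf' : HasFDerivAt f (fderiv ℝ f x₀) (t⁻¹ • (t • x₀)) := by
        have : t⁻¹ • (t • x₀) = x₀ := hux
        rw [this]
        exact (hf.differentiableAt hk0).hasFDerivAt
      have := hf'.comp_hasDerivAt t hc
      have e : -(t⁻¹) * fderiv ℝ f x₀ x₀ = fderiv ℝ f x₀ ((-(t ^ 2)⁻¹) • (t • x₀)) := by
        rw [map_smul, map_smul, smul_eq_mul, smul_eq_mul]
        field_simp
      rw [e]
      exact this
    intro μ
    rw [← h1.unique h2]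
    have : (ContinuousLinearMap.inr ℝ E ℝ) μ = μ • ((0 : E), (1 : ℝ)) := by simp
    rw [ContinuousLinearMap.comp_apply, this, map_smul, smul_eq_mul, mul_comm]
  set a : ℝ := -(t⁻¹) * fderiv ℝ f x₀ x₀ with ha
  have ha0 : a ≠ 0 := mul_ne_zero (neg_ne_zero.2 (inv_ne_zero ht.ne')) htr
  have hinv : (fderiv ℝ F u ∘L .inr ℝ E ℝ).IsInvertible := by
    refine ⟨ContinuousLinearEquiv.unitsEquivAut ℝ (Units.mk0 a ha0), ?_⟩
    ext
    rw [hval]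
    simp
  have hFu : F u = 0 := by simp only [hF]; rw [hux, hfx]
  have hev := hFc.eventually_apply_eq_iff_implicitFunction hk0 hinv
  have hψ := hFc.contDiffAt_implicitFunction hk0 hinv
  have htend : Tendsto (fun x => (x, φ x)) (𝓝 (t • x₀)) (𝓝 u) := by
    have : ContinuousAt (fun x => (x, φ x)) (t • x₀) := continuousAt_id.prodMk hφ
    have h := this.tendsto
    rwa [hφt] at h
  refine hψ.congr_of_eventuallyEq ?_
  filter_upwards [htend.eventually hev, hz] with x h1 h2
  exact (h1.1 (by rw [hFu]; exact h2)).symm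

theorem gauge_holAt {E : Type} [NormedAddCommGroup E] [NormedSpace ℝ E] [CompleteSpace E]
    {α : ℝ} (h0 : 0 ≤ α) (h1 : α ≤ 1)
    {φ : E → ℝ} {x₀ : E} {t : ℝ} (ht : 0 < t) (hφ : ContinuousAt φ (t • x₀)) (hφt : φ (t • x₀) = t)
    {k : ℕ} {f : E → ℝ} (hf : HolAt (k + 1) α f x₀) (hfx : f x₀ = 0)
    (htr : fderiv ℝ f x₀ x₀ ≠ 0)
    (hz : ∀ᶠ x in 𝓝 (t • x₀), f ((φ x)⁻¹ • x) = 0) : HolAt (k + 1) α φ (t • x₀) := by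
  have hC : ContDiffAt ℝ (k + 1 : ℕ) φ (t • x₀) :=
    gauge_contDiffAt ht hφ hφt (by omega) hf.1 hfx htr hz
  have hf' := holAt_succ_iff.1 hf
  have hC' := contDiffAt_succ_iff'.1 hC
  have hid : HolAt k α (fun y : E => y) x₀ := contDiffAt_id.holAt h1
  have hu : HolAt k α (fun y => fderiv ℝ f y y) x₀ :=
    HolAt.bilin h1 k (ContinuousLinearMap.id ℝ (E →L[ℝ] ℝ)) hf'.2 hid
  have hG : HolAt k α (fun y => (fderiv ℝ f y y)⁻¹ • fderiv ℝ f y) x₀ :=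
    HolAt.bilin h1 k (ContinuousLinearMap.lsmul ℝ ℝ) (hu.inv h0 h1 k htr) hf'.2
  set y : E → E := fun x => (φ x)⁻¹ • x with hy
  have hyx : y (t • x₀) = x₀ := by simp [hy, hφt, smul_smul, ht.ne']
  have hyC : ContDiffAt ℝ (k + 1 : ℕ) y (t • x₀) :=
    (hC.inv (by rw [hφt]; exact ht.ne')).smul contDiffAt_id
  have hcomp : HolAt k α (fun x => (fderiv ℝ f (y x) (y x))⁻¹ • fderiv ℝ f (y x)) (t • x₀) :=
    HolAt.comp h0 h1 k (f := y) (by rw [hyx]; exact hG) hyC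
  rw [holAt_succ_iff]
  refine ⟨hC'.1, hcomp.congr ?_⟩
  have hyt : Tendsto y (𝓝 (t • x₀)) (𝓝 x₀) := by
    have := hyC.continuousAt.tendsto
    rwa [hyx] at this
  filter_upwards [hC'.1, hyt.eventually hf'.1, hyt.eventually (hu.1.continuousAt.eventually_ne htr),
    hz.eventually_nhds, hφ.eventually_ne (by rw [hφt]; exact ht.ne')] with x a1 a2 a3 a4 a5
  have hd1 : HasFDerivAt y ((φ x)⁻¹ • ContinuousLinearMap.id ℝ E +
      ((-((φ x) ^ 2)⁻¹) • fderiv ℝ φ x).smulRight x) x := by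
    have b1 : HasFDerivAt (fun x => (φ x)⁻¹) ((-((φ x) ^ 2)⁻¹) • fderiv ℝ φ x) x :=
      (hasDerivAt_inv a5).comp_hasFDerivAt x a1.hasFDerivAt
    exact b1.smul (hasFDerivAt_id x)
  have hd2 := a2.hasFDerivAt.comp x hd1
  have hd3 : HasFDerivAt (f ∘ y) (0 : E →L[ℝ] ℝ) x :=
    (hasFDerivAt_const (0 : ℝ) x).congr_of_eventuallyEq a4
  have heq := hd2.unique hd3
  ext v
  have hv := congrArg (fun T : E →L[ℝ] ℝ => T v) heq
  have hxy : x = φ x • y x := by simp [hy, smul_smul, a5]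
  have hDx : fderiv ℝ f (y x) x = φ x * fderiv ℝ f (y x) (y x) := by
    rw [← smul_eq_mul, ← map_smul, ← hxy]
  simp [hDx] at hv
  simp only [smul_apply, smul_eq_mul]
  field_simp at hv ⊢
  linarith

/-- If `∂K` is `C^{k,α}` (`k ≥ 1`, `0 ≤ α ≤ 1`) near a point `x₀ ∈ ∂K` — i.e. near `x₀` the
boundary `∂K` is the zero set of a `C^{k,α}` function with nonvanishing gradient — then the gauge
`γ_K` is `C^{k,α}` on a neighborhood of every point `t • x₀` with `t > 0`. -/
theorem gauge_CkAlpha_of_boundary_CkAlpha {n : ℕ} (K : Set (EuclideanSpace ℝ (Fin n)))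
    (hKc : IsCompact K) (hKconv : Convex ℝ K) (h0 : (0 : EuclideanSpace ℝ (Fin n)) ∈ interior K)
    (k : ℕ) (hk : 1 ≤ k) (α : ℝ) (hα0 : 0 ≤ α) (hα1 : α ≤ 1)
    (x₀ : EuclideanSpace ℝ (Fin n)) (hx₀ : x₀ ∈ frontier K)
    (hbdry : ∃ V : Set (EuclideanSpace ℝ (Fin n)), IsOpen V ∧ x₀ ∈ V ∧
      ∃ f : EuclideanSpace ℝ (Fin n) → ℝ, IsCkAlphaOn k α f V ∧
        frontier K ∩ V = {x ∈ V | f x = 0} ∧ ∀ x ∈ V, fderiv ℝ f x ≠ 0) :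
    ∀ t : ℝ, 0 < t → ∃ W : Set (EuclideanSpace ℝ (Fin n)), IsOpen W ∧ t • x₀ ∈ W ∧
      IsCkAlphaOn k α (gauge K) W := by
  obtain ⟨V, hVo, hxV, f, hf, hfr, hne⟩ := hbdry
  have hK0 : K ∈ 𝓝 (0 : EuclideanSpace ℝ (Fin n)) := mem_interior_iff_mem_nhds.1 h0
  have hVn : V ∈ 𝓝 x₀ := hVo.mem_nhds hxV
  have hz : ∀ x ∈ V, f x = 0 ↔ gauge K x = 1 := by
    intro x hx
    rw [gauge_eq_one_iff_mem_frontier hKconv hK0]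
    have := Set.ext_iff.1 hfr x
    simp only [Set.mem_inter_iff, Set.mem_sep_iff] at this
    tauto
  have hg1 : gauge K x₀ = 1 := (gauge_eq_one_iff_mem_frontier hKconv hK0).2 hx₀
  have hfx : f x₀ = 0 := (hz x₀ hxV).2 hg1
  have hfH : HolAt k α f x₀ := by
    refine ⟨hf.1.contDiffAt hVn, ?_⟩
    obtain ⟨C, hC, h⟩ := hf.2
    refine ⟨C, hC, ?_⟩
    filter_upwards [both_eventually hVn] with p hp
    rw [← iteratedFDerivWithin_of_isOpen k hVo hp.1, ← iteratedFDerivWithin_of_isOpen k hVo hp.2]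
    exact h _ hp.1 _ hp.2
  obtain ⟨k, rfl⟩ : ∃ m, k = m + 1 := ⟨k - 1, by omega⟩
  have htr : fderiv ℝ f x₀ x₀ ≠ 0 :=
    transversal hKconv hK0 hg1 hVn hf.1.continuousOn
      ((holAt_succ_iff.1 hfH).1.self_of_nhds) hz (hne x₀ hxV)
  intro t ht
  have hφ : Continuous (gauge K) := continuous_gauge hKconv hK0
  have hφt : gauge K (t • x₀) = t := by
    rw [gauge_smul_of_nonneg ht.le, hg1, smul_eq_mul, mul_one]
  have hev : ∀ᶠ x in 𝓝 (t • x₀), f ((gauge K x)⁻¹ • x) = 0 := by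
    have hpos : ∀ᶠ x in 𝓝 (t • x₀), 0 < gauge K x :=
      hφ.continuousAt.eventually (lt_mem_nhds (by rw [hφt]; exact ht))
    have hc : ContinuousAt (fun x => (gauge K x)⁻¹ • x) (t • x₀) :=
      (hφ.continuousAt.inv₀ (by rw [hφt]; exact ht.ne')).smul continuousAt_id
    have hcV : ∀ᶠ x in 𝓝 (t • x₀), (gauge K x)⁻¹ • x ∈ V := by
      refine hc.eventually (hVo.mem_nhds ?_)
      simpa [hφt, smul_smul, ht.ne'] using hxV
    filter_upwards [hpos, hcV] with x h1 h2
    rw [hz _ h2, gauge_smul_of_nonneg (inv_nonneg.2 h1.le), smul_eq_mul, inv_mul_cancel₀ h1.ne']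
  obtain ⟨hcd, C, hC, hh⟩ := gauge_holAt hα0 hα1 ht hφ.continuousAt hφt hfH hfx htr hev
  have hcd' := hcd.eventually (by simp)
  rw [nhds_prod_eq, eventually_prod_self_iff'] at hh
  obtain ⟨U, hU, hUU⟩ := hh
  obtain ⟨W, hWs, hWo, hW⟩ := mem_nhds_iff.1 (Filter.inter_mem hU hcd')
  have hW2 : ∀ x ∈ W, ContDiffAt ℝ (k + 1 : ℕ) (gauge K) x := by
    intro x hx
    have h := (hWs hx).2
    exact h
  refine ⟨W, hWo, hW, fun x hx => (hW2 x hx).contDiffWithinAt, C, hC, fun x hx y hy => ?_⟩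
  rw [iteratedFDerivWithin_of_isOpen _ hWo hx, iteratedFDerivWithin_of_isOpen _ hWo hy]
  exact hUU x (hWs hx).1 y (hWs hy).1
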